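/- Suppose (M, a, s) is a solution with M ≡ 2 (mod 24), and set m = (M − 2)/12. Then: if m ≡ 0 (mod 6), then a ≡ 0 or 2 (mod 3) and s ≡ 1 or 5 (mod 6); if m ≡ 2 (mod 6), then a ≡ 1 (mod 3) and s ≡ 3 (mod 6); and if m ≡ 4 (mod 6), then s is odd. -/

import Mathlib

theorem six_mul_sum_range_add_sq (a n : ℕ) :
    6 * ∑ i ∈ Finset.range n, (a + i) ^ 2 + 6 * a * n + 3 * n ^ 2 =
      6 * n * a ^ 2 + 6 * a * n ^ 2 + 2 * n ^ 3 + n := by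
  induction n with
  | zero => simp
  | succ n ih =>
    rw [Finset.sum_range_succ]
    linear_combination ih

theorem sum_range_add_sq_of_eq_twentyfour_mul_add_two (a k : ℕ) :
    ∑ i ∈ Finset.range (24 * k + 2), (a + i) ^ 2 =
      (24 * k + 2) * a ^ 2 + a * (24 * k + 2) * (24 * k + 1) +
        (24 * k + 1) * (12 * k + 1) * (16 * k + 1) := by
  have h := six_mul_sum_range_add_sq a (24 * k + 2)
  refine Nat.eq_of_mul_eq_mul_left (show 0 < 6 by norm_num) ?_
  linear_combination h

theorem solution_M_mod_two_congruences (M a s : ℕ) (hM : 1 ≤ M) (ha : 1 ≤ a) (hs : 1 ≤ s)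
    (hsol : ∑ i ∈ Finset.range M, (a + i) ^ 2 = s ^ 2)
    (hmod : M % 24 = 2) (m : ℕ) (hm : m = (M - 2) / 12) :
    (m % 6 = 0 → (a % 3 = 0 ∨ a % 3 = 2) ∧ (s % 6 = 1 ∨ s % 6 = 5)) ∧
    (m % 6 = 2 → a % 3 = 1 ∧ s % 6 = 3) ∧
    (m % 6 = 4 → Odd s) := by
  obtain ⟨k, rfl⟩ : ∃ k, M = 24 * k + 2 := ⟨M / 24, by omega⟩
  obtain rfl : m = 2 * k := by omega
  rw [sum_range_add_sq_of_eq_twentyfour_mul_add_two] at hsol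
  have hodd : Odd s := by
    rw [← Nat.odd_pow_iff two_ne_zero, ← hsol]
    exact ⟨(12 * k + 1) * a ^ 2 + a * (12 * k + 1) * (24 * k + 1) +
      (2304 * k ^ 3 + 432 * k ^ 2 + 26 * k), by ring⟩
  have hs2 : s % 2 = 1 := Nat.odd_iff.mp hodd
  have h3 : (2 * a ^ 2 + 2 * a + (k + 1)) % 3 = s ^ 2 % 3 := by
    rw [← hsol]
    have e : (24 * k + 2) * a ^ 2 + a * (24 * k + 2) * (24 * k + 1) +
        (24 * k + 1) * (12 * k + 1) * (16 * k + 1) =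
        2 * a ^ 2 + 2 * a + (k + 1) + 3 * (8 * k * a ^ 2 + a * (192 * k ^ 2 + 24 * k) +
          (1536 * k ^ 3 + 288 * k ^ 2 + 17 * k)) := by ring
    rw [e, Nat.add_mul_mod_self_left]
  have key : (k % 3 = 0 → (a % 3 = 0 ∨ a % 3 = 2) ∧ s % 3 ≠ 0) ∧
      (k % 3 = 1 → a % 3 = 1 ∧ s % 3 = 0) := by
    have hk : k % 3 = 0 ∨ k % 3 = 1 ∨ k % 3 = 2 := by omega
    have ha3 : a % 3 = 0 ∨ a % 3 = 1 ∨ a % 3 = 2 := by omega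
    have hs3 : s % 3 = 0 ∨ s % 3 = 1 ∨ s % 3 = 2 := by omega
    rcases hk with hk | hk | hk <;> rcases ha3 with ha3 | ha3 | ha3 <;>
      rcases hs3 with hs3 | hs3 | hs3 <;>
      simp [Nat.add_mod, Nat.mul_mod, Nat.pow_mod, hk, ha3, hs3] at h3 ⊢
  refine ⟨fun h => ?_, fun h => ?_, fun _ => hodd⟩
  · have := key.1 (by omega)
    omega
  · have := key.2 (by omega)
    omega
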